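/- Let n ≥ 1 and let x₁,...,x_{2n} be elements of a commutative ring. Define a_{i,j} = (x_i − x_j)² for 1 ≤ i < j ≤ 2n, and let pf_{2n} be the Pfaffian of this triangular array (the signed sum over perfect matchings). Then pf_{2n} = −(−2)^{n-1} · (x₁−x₂)(x₂−x₃)···(x_{2n-1}−x_{2n})(x_{2n}−x₁). -/

import Mathlib

open Finset

/-- The set of Pfaff permutations of `{0, ..., 2n-1}`: written in one line as
`(i₁, j₁, ..., iₙ, jₙ)` with `i₁ < i₂ < ⋯ < iₙ` and `iₛ < jₛ` for all `s`. -/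
def pfaffPerms (n : ℕ) : Finset (Equiv.Perm (Fin (2*n))) :=
  Finset.univ.filter fun σ =>
    (∀ k : Fin n, σ ⟨2*k.1, by have := k.2; omega⟩ < σ ⟨2*k.1+1, by have := k.2; omega⟩) ∧
    ∀ k l : Fin n, k < l →
      σ ⟨2*k.1, by have := k.2; omega⟩ < σ ⟨2*l.1, by have := l.2; omega⟩

/-- The Pfaffian of a triangular array `(a i j)_{i<j}`:
the alternating sum over Pfaff permutations of the products `a i₁ j₁ ⋯ a iₙ jₙ`. -/
def pf (n : ℕ) {R : Type*} [CommRing R] (a : Fin (2*n) → Fin (2*n) → R) : R :=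
  ∑ σ ∈ pfaffPerms n,
    ((Equiv.Perm.sign σ : ℤ) : R) *
      ∏ k : Fin n, a (σ ⟨2*k.1, by have := k.2; omega⟩) (σ ⟨2*k.1+1, by have := k.2; omega⟩)

instance (m : ℕ) : NeZero (2*(m+1)) := ⟨by omega⟩

/-- The permutation `(0, j + 1, τ 0, τ 1, …)`, where `τ` is transported along the increasing
enumeration of the complement of `{0, j + 1}`. -/
def consPairPerm {N : ℕ} (j : Fin (N + 1)) (τ : Equiv.Perm (Fin N)) :
    Equiv.Perm (Fin (N + 2)) :=
  Equiv.Perm.decomposeFin.symm (0, j.cycleRange.symm * Equiv.Perm.decomposeFin.symm (0, τ))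

lemma consPairPerm_zero {N : ℕ} (j : Fin (N + 1)) (τ : Equiv.Perm (Fin N)) :
    consPairPerm j τ 0 = 0 := by
  simp [consPairPerm]

lemma consPairPerm_one {N : ℕ} (j : Fin (N + 1)) (τ : Equiv.Perm (Fin N)) :
    consPairPerm j τ 1 = j.succ := by
  simp [consPairPerm, ← Fin.succ_zero_eq_one, - Fin.succ_zero_eq_one']

lemma consPairPerm_succ_succ {N : ℕ} (j : Fin (N + 1)) (τ : Equiv.Perm (Fin N)) (k : Fin N) :
    consPairPerm j τ k.succ.succ = (j.succAbove (τ k)).succ := by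
  simp [consPairPerm]

lemma sign_consPairPerm {N : ℕ} (j : Fin (N + 1)) (τ : Equiv.Perm (Fin N)) :
    Equiv.Perm.sign (consPairPerm j τ) = (-1) ^ (j : ℕ) * Equiv.Perm.sign τ := by
  simp [consPairPerm]

lemma consPairPerm_injective {N : ℕ} {j j' : Fin (N + 1)} {τ τ' : Equiv.Perm (Fin N)}
    (h : consPairPerm j τ = consPairPerm j' τ') : j = j' ∧ τ = τ' := by
  have hj : j = j' := by
    have := congrArg (fun σ => σ 1) h
    simpa [consPairPerm_one] using this
  subst hj
  refine ⟨rfl, ?_⟩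
  simpa [consPairPerm] using h

lemma exists_decomposeFin_symm_zero {N : ℕ} (σ : Equiv.Perm (Fin (N + 1))) (h : σ 0 = 0) :
    ∃ τ, Equiv.Perm.decomposeFin.symm (0, τ) = σ := by
  obtain ⟨⟨p, τ⟩, rfl⟩ := Equiv.Perm.decomposeFin.symm.surjective σ
  rw [Equiv.Perm.decomposeFin_symm_apply_zero] at h
  exact ⟨τ, by rw [h]⟩

lemma exists_consPairPerm {N : ℕ} (σ : Equiv.Perm (Fin (N + 2))) (h : σ 0 = 0) :
    ∃ j τ, consPairPerm j τ = σ := by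
  obtain ⟨ρ, rfl⟩ := exists_decomposeFin_symm_zero σ h
  obtain ⟨τ, hτ⟩ := exists_decomposeFin_symm_zero ((ρ 0).cycleRange * ρ) (by simp)
  refine ⟨ρ 0, τ, ?_⟩
  rw [consPairPerm, hτ, ← mul_assoc]
  congr 2
  ext i
  simp

lemma apply_zero_of_mem_pfaffPerms {n : ℕ} {σ : Equiv.Perm (Fin (2 * (n + 1)))}
    (h : σ ∈ pfaffPerms (n + 1)) : σ 0 = 0 := by
  simp only [pfaffPerms, mem_filter, mem_univ, true_and] at h
  obtain ⟨h1, h2⟩ := h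
  obtain ⟨k, hk⟩ := σ.surjective 0
  have hlt : ∀ i, ¬ i < σ k := by
    intro i hi
    rw [hk] at hi
    exact absurd hi (Fin.not_lt_zero i)
  obtain ⟨l, hl | hl⟩ := Nat.even_or_odd' k.1
  · have hln : l < n + 1 := by omega
    rcases Nat.eq_zero_or_pos l with rfl | hpos
    · have : k = 0 := Fin.ext (by simpa using hl)
      rw [← this, hk, this]
    · have := h2 ⟨0, by omega⟩ ⟨l, hln⟩ hpos
      have hkl : k = ⟨2 * l, by omega⟩ := Fin.ext hl
      rw [hkl] at hlt
      exact absurd this (hlt _)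
  · have := h1 ⟨l, by omega⟩
    have hkl : k = ⟨2 * l + 1, by omega⟩ := Fin.ext hl
    rw [hkl] at hlt
    exact absurd this (hlt _)

lemma consPairPerm_mem_pfaffPerms {n : ℕ} (j : Fin (2 * n + 1)) (τ : Equiv.Perm (Fin (2 * n))) :
    (consPairPerm j τ : Equiv.Perm (Fin (2 * (n + 1)))) ∈ pfaffPerms (n + 1) ↔
      τ ∈ pfaffPerms n := by
  have key : ∀ (k : ℕ) (hk : k < 2 * n) (hk' : k + 2 < 2 * n + 2),
      consPairPerm j τ ⟨k + 2, hk'⟩ = (j.succAbove (τ ⟨k, hk⟩)).succ :=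
    fun k hk _ => consPairPerm_succ_succ j τ ⟨k, hk⟩
  simp only [pfaffPerms, mem_filter, mem_univ, true_and]
  constructor
  · rintro ⟨h1, h2⟩
    refine ⟨fun k => ?_, fun k l hkl => ?_⟩
    · have := h1 k.succ
      erw [key (2 * k) (by omega) (by omega), key (2 * k + 1) (by omega) (by omega)] at this
      simpa using this
    · have := h2 k.succ l.succ (by simpa using hkl)
      erw [key (2 * k) (by omega) (by omega), key (2 * l) (by omega) (by omega)] at this
      simpa using this
  · rintro ⟨h1, h2⟩
    refine ⟨fun k => ?_, fun k l hkl => ?_⟩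
    · cases k using Fin.cases with
      | zero =>
        erw [consPairPerm_zero, consPairPerm_one]
        exact Fin.succ_pos j
      | succ k =>
        erw [key (2 * k) (by omega) (by omega), key (2 * k + 1) (by omega) (by omega)]
        simpa using h1 k
    · cases l using Fin.cases with
      | zero => exact absurd hkl (Fin.not_lt_zero k)
      | succ l =>
        erw [key (2 * l) (by omega) (by omega)]
        cases k using Fin.cases with
        | zero =>
          erw [consPairPerm_zero]
          exact Fin.succ_pos _
        | succ k =>
          erw [key (2 * k) (by omega) (by omega)]
          simpa using h2 k l (by simpa using hkl)

/-- Expansion of the Pfaffian along its first row. -/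
lemma pf_succ {R : Type*} [CommRing R] (n : ℕ)
    (a : Fin (2 * n + 2) → Fin (2 * n + 2) → R) :
    pf (n + 1) a = ∑ j : Fin (2 * n + 1), (-1) ^ (j : ℕ) * a 0 j.succ *
      pf n fun k l => a (j.succAbove k).succ (j.succAbove l).succ := by
  simp only [pf, mul_sum]
  rw [← sum_product']
  symm
  refine sum_bij (fun p _ => consPairPerm p.1 p.2) ?_ ?_ ?_ ?_
  · rintro ⟨j, τ⟩ h
    exact (consPairPerm_mem_pfaffPerms j τ).2 (mem_product.1 h).2
  · rintro ⟨j, τ⟩ _ ⟨j', τ'⟩ _ h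
    obtain ⟨rfl, rfl⟩ := consPairPerm_injective h
    rfl
  · intro σ hσ
    obtain ⟨j, τ, rfl⟩ := exists_consPairPerm (N := 2 * n) σ (apply_zero_of_mem_pfaffPerms hσ)
    exact ⟨(j, τ), mem_product.2 ⟨mem_univ _, (consPairPerm_mem_pfaffPerms j τ).1 hσ⟩, rfl⟩
  · rintro ⟨j, τ⟩ _
    have hprod : ∏ k : Fin (n + 1),
        a (consPairPerm j τ ⟨2 * k.1, by have := k.2; omega⟩)
          (consPairPerm j τ ⟨2 * k.1 + 1, by have := k.2; omega⟩) =
        a 0 j.succ * ∏ k : Fin n,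
          a (j.succAbove (τ ⟨2 * k.1, by have := k.2; omega⟩)).succ
            (j.succAbove (τ ⟨2 * k.1 + 1, by have := k.2; omega⟩)).succ := by
      rw [Fin.prod_univ_succ]
      congr 1
      · exact congrArg₂ a (consPairPerm_zero j τ) (consPairPerm_one j τ)
      · refine prod_congr rfl fun k _ => ?_
        exact congrArg₂ a (consPairPerm_succ_succ j τ ⟨2 * k.1, by omega⟩)
          (consPairPerm_succ_succ j τ ⟨2 * k.1 + 1, by omega⟩)
    have hsign : ((Equiv.Perm.sign (consPairPerm j τ) : ℤ) : R) =
        (-1) ^ (j : ℕ) * ((Equiv.Perm.sign τ : ℤ) : R) := by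
      rw [sign_consPairPerm]
      push_cast
      ring
    refine Eq.trans ?_ (congrArg₂ (· * ·) hsign hprod).symm
    simp only
    ring

lemma prod_sub_add_one {R : Type*} [CommRing R] {N : ℕ} (y : Fin (N + 1) → R) :
    ∏ i, (y i - y (i + 1)) =
      (∏ i : Fin N, (y i.castSucc - y i.succ)) * (y (Fin.last N) - y 0) := by
  simp [Fin.prod_univ_castSucc]

lemma succAbove_add_one {N : ℕ} (j : Fin (N + 2)) (i : Fin (N + 1)) :
    j.succAbove (i + 1) =
      if j.succAbove i = j - 1 then j + 1 else j.succAbove i + 1 := by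
  have hi := i.2
  have hj := j.2
  simp only [eq_sub_iff_add_eq, Fin.ext_iff, Fin.succAbove, Fin.lt_def, Fin.val_castSucc,
    Fin.val_add_one, apply_ite Fin.val, Fin.val_succ, Fin.val_last]
  split_ifs <;> omega

/-- Deleting one point from a cyclic product of differences. -/
lemma prod_succAbove_sub {R : Type*} [CommRing R] {N : ℕ} (y : Fin (N + 2) → R)
    (j : Fin (N + 2)) :
    ∏ i, (y (j.succAbove i) - y (j.succAbove (i + 1))) =
      ∏ i ∈ univ.erase (j - 1), (y i - y (i + 1)) + ∏ i ∈ univ.erase j, (y i - y (i + 1)) := by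
  have hne : j - 1 ≠ j := by simp
  have h1 : ∏ i, (y (j.succAbove i) - y (j.succAbove (i + 1))) =
      ∏ k ∈ univ.erase j, (y k - y (if k = j - 1 then j + 1 else k + 1)) := by
    simp only [succAbove_add_one]
    rw [← compl_singleton, ← Fin.image_succAbove_univ,
      prod_image (Fin.succAbove_right_injective.injOn)]
  have h2 : ∏ k ∈ (univ.erase j).erase (j - 1), (y k - y (if k = j - 1 then j + 1 else k + 1)) =
      ∏ k ∈ (univ.erase j).erase (j - 1), (y k - y (k + 1)) :=
    prod_congr rfl fun k hk => by rw [if_neg (mem_erase.1 hk).1]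
  rw [h1, ← mul_prod_erase _ _ (mem_erase.2 ⟨hne, mem_univ (j - 1)⟩), h2,
    ← mul_prod_erase (univ.erase j) _ (mem_erase.2 ⟨hne, mem_univ (j - 1)⟩),
    ← mul_prod_erase (univ.erase (j - 1)) _ (mem_erase.2 ⟨hne.symm, mem_univ j⟩),
    erase_right_comm]
  simp only [if_true, sub_add_cancel]
  ring

lemma sum_neg_one_pow_mul_add {R : Type*} [CommRing R] {N : ℕ} (u : Fin (N + 1) → R) :
    ∑ j : Fin N, (-1) ^ (j : ℕ) * (u j.castSucc + u j.succ) =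
      u 0 - (-1) ^ N * u (Fin.last N) := by
  induction N with
  | zero => simp
  | succ N ih =>
    rw [Fin.sum_univ_castSucc]
    have := ih (fun i => u i.castSucc)
    simp only [Fin.val_castSucc, Fin.val_last, Fin.succ_last, ← Fin.succ_castSucc,
      Fin.castSucc_zero] at this ⊢
    rw [this]
    ring

/-- The alternating sum of cyclic products with one point deleted, weighted by squared
differences to a further point `c`. -/
lemma sum_sq_mul_prod_succAbove {R : Type*} [CommRing R] {N : ℕ} (hN : Odd N)
    (c : R) (y : Fin (N + 2) → R) :
    ∑ j : Fin (N + 2), (-1) ^ (j : ℕ) * (c - y j) ^ 2 *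
        ∏ i, (y (j.succAbove i) - y (j.succAbove (i + 1))) =
      -2 * ((c - y 0) * (∏ i : Fin (N + 1), (y i.castSucc - y i.succ)) *
        (y (Fin.last (N + 1)) - c)) := by
  set E : Fin (N + 2) → R := fun j => ∏ i ∈ univ.erase j, (y i - y (i + 1)) with hE
  have hmul : ∀ j, (y j - y (j + 1)) * E j = ∏ i, (y i - y (i + 1)) := fun j =>
    mul_prod_erase univ (fun i => y i - y (i + 1)) (mem_univ j)
  have hlast : E (Fin.last (N + 1)) = ∏ i : Fin (N + 1), (y i.castSucc - y i.succ) := by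
    have himage : univ.erase (Fin.last (N + 1)) = univ.image Fin.castSucc := by
      rw [← compl_singleton, ← Fin.image_succAbove_univ, Fin.succAbove_last]
    rw [hE]
    simp only [himage]
    rw [prod_image (Fin.castSucc_injective _).injOn]
    simp
  have hshift : ∑ j : Fin (N + 2), (-1) ^ (j : ℕ) * (c - y j) ^ 2 * E (j - 1) =
      ∑ j : Fin (N + 2), (-1) ^ ((j + 1 : Fin (N + 2)) : ℕ) * (c - y (j + 1)) ^ 2 * E j := by
    rw [← Equiv.sum_comp (Equiv.addRight (1 : Fin (N + 2)))]
    simp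
  have hdel : ∀ j : Fin (N + 2), ∏ i, (y (j.succAbove i) - y (j.succAbove (i + 1))) =
      E (j - 1) + E j := prod_succAbove_sub y
  clear_value E
  simp only [hdel, mul_add, sum_add_distrib]
  rw [hshift, Fin.sum_univ_castSucc, Fin.sum_univ_castSucc (n := N + 1)]
  have htel := sum_neg_one_pow_mul_add y
  have hpow : (-1 : R) ^ (N + 1) = 1 := (hN.add_one).neg_one_pow
  have hones : ∑ j : Fin (N + 1), (-1 : R) ^ (j : ℕ) * (c + c) = c - (-1) ^ (N + 1) * c :=
    sum_neg_one_pow_mul_add fun _ => c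
  have hsum : ∑ j : Fin (N + 1), (-1) ^ ((j.castSucc + 1 : Fin (N + 2)) : ℕ) *
        (c - y (j.castSucc + 1)) ^ 2 * E j.castSucc +
      ∑ j : Fin (N + 1), (-1) ^ (j.castSucc : ℕ) * (c - y j.castSucc) ^ 2 * E j.castSucc =
      (y 0 - y (Fin.last (N + 1))) * ∏ i, (y i - y (i + 1)) := by
    rw [hpow, one_mul] at htel hones
    rw [← sum_add_distrib, ← htel, ← sub_zero (∑ j : Fin (N + 1), _ * (y _ + _)),
      ← sub_self c, ← hones, ← sum_sub_distrib, sum_mul]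
    refine sum_congr rfl fun j _ => ?_
    rw [← hmul j.castSucc]
    simp only [Fin.coeSucc_eq_succ, Fin.val_succ, Fin.val_castSucc, pow_succ]
    ring
  have hP := hmul (Fin.last (N + 1))
  simp only [Fin.last_add_one, Fin.val_zero, Fin.val_last, pow_zero, hpow, ← hP, hlast] at hsum ⊢
  linear_combination hsum

/-- Pfaffian of the triangular array `(xᵢ - xⱼ)²` equals
`-(-2)^(n-1) (x₁-x₂)(x₂-x₃)⋯(x₂ₙ₋₁-x₂ₙ)(x₂ₙ-x₁)`, where `n = m+1 ≥ 1` and the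
index `i + 1` in the product is taken cyclically. -/
theorem pf_sq_diff {R : Type*} [CommRing R] (m : ℕ) (x : Fin (2*(m+1)) → R) :
    pf (m+1) (fun i j => (x i - x j)^2) =
      -(-2 : R)^m * ∏ i : Fin (2*(m+1)), (x i - x (i + 1)) := by
  induction m with
  | zero =>
    rw [pf_succ]
    have h0 : ∀ a : Fin (2 * 0) → Fin (2 * 0) → R, pf 0 a = 1 := by
      intro a
      simp [pf, pfaffPerms]
    simp [h0]
    ring
  | succ m ih =>
    rw [pf_succ]
    simp only [ih]
    have h := sum_sq_mul_prod_succAbove (N := 2 * m + 1) ⟨m, rfl⟩ (x 0) (fun i => x i.succ)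
    have hcyc : ∏ i : Fin (2 * (m + 1 + 1)), (x i - x (i + 1)) =
        (x 0 - x (Fin.succ 0)) * (∏ i : Fin (2 * m + 2), (x i.castSucc.succ - x i.succ.succ)) *
          (x (Fin.last (2 * m + 2)).succ - x 0) := by
      refine (prod_sub_add_one (N := 2 * m + 3) x).trans ?_
      rw [Fin.prod_univ_succ]
      rfl
    rw [hcyc]
    refine Eq.trans ?_ ((congrArg (-(-2 : R) ^ m * ·) h).trans ?_)
    · rw [mul_sum]
      refine sum_congr rfl fun j _ => ?_
      exact mul_left_comm _ _ _
    · ring
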